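/- If R is a ring with finite weak global dimension wdim(R) < ∞, then l.Gwdim(R) = wdim(R) = r.Gwdim(R). -/

import Mathlib

/-!
Background definitions for D. Bennis, "Weak Gorenstein global dimensions".

Conventions.  All rings are associative with identity.  A *left* `R`-module is a type with
`[AddCommGroup M] [Module R M]`; a *right* `R`-module is a left module over the opposite ring,
i.e. `[Module Rᵐᵒᵖ M]`.  All "right-handed" notions below are obtained by applying the
corresponding "left-handed" notion to the opposite ring `Rᵐᵒᵖ`.
-/

open MulOpposite

universe u

section Tensor

variable (S : Type u) [Ring S]

/-- The subgroup of relations defining the tensor product `A ⊗_S M` of a right `S`-module `A`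
and a left `S`-module `M` over a (possibly noncommutative) ring `S`. -/
def tensorRels (A : Type u) [AddCommGroup A] [Module Sᵐᵒᵖ A]
    (M : Type u) [AddCommGroup M] [Module S M] :
    AddSubgroup (FreeAbelianGroup (A × M)) :=
  AddSubgroup.closure
    { x | (∃ a₁ a₂ m, x = FreeAbelianGroup.of (a₁ + a₂, m) - FreeAbelianGroup.of (a₁, m) -
            FreeAbelianGroup.of (a₂, m)) ∨
          (∃ a m₁ m₂, x = FreeAbelianGroup.of (a, m₁ + m₂) - FreeAbelianGroup.of (a, m₁) -
            FreeAbelianGroup.of (a, m₂)) ∨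
          (∃ (a : A) (r : S) (m : M), x = FreeAbelianGroup.of (op r • a, m) - FreeAbelianGroup.of (a, r • m)) }

/-- The tensor product `A ⊗_S M` (an abelian group) of a right `S`-module `A` and a left
`S`-module `M` over a (possibly noncommutative) ring `S`. -/
def NTensor (A : Type u) [AddCommGroup A] [Module Sᵐᵒᵖ A]
    (M : Type u) [AddCommGroup M] [Module S M] : Type u :=
  FreeAbelianGroup (A × M) ⧸ tensorRels S A M

instance (A : Type u) [AddCommGroup A] [Module Sᵐᵒᵖ A]
    (M : Type u) [AddCommGroup M] [Module S M] : AddCommGroup (NTensor S A M) :=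
  QuotientAddGroup.Quotient.addCommGroup _

namespace NTensor

variable {S}
variable {A A' : Type u} [AddCommGroup A] [Module Sᵐᵒᵖ A] [AddCommGroup A'] [Module Sᵐᵒᵖ A']
variable {M M' : Type u} [AddCommGroup M] [Module S M] [AddCommGroup M'] [Module S M']

/-- Functoriality of `A ⊗_S −` : the map `A ⊗_S M → A ⊗_S M'` induced by a linear map
`g : M → M'` of left `S`-modules. -/
def rmap (A : Type u) [AddCommGroup A] [Module Sᵐᵒᵖ A] (g : M →ₗ[S] M') :
    NTensor S A M →+ NTensor S A M' :=
  QuotientAddGroup.map (tensorRels S A M) (tensorRels S A M') (FreeAbelianGroup.map (Prod.map id g)) (by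
    simp only [tensorRels]
    refine (AddSubgroup.closure_le _).2 ?_
    rintro x (⟨a₁, a₂, m, rfl⟩ | ⟨a, m₁, m₂, rfl⟩ | ⟨a, r, m, rfl⟩) <;>
      refine SetLike.mem_coe.2 (AddSubgroup.mem_comap.2 (AddSubgroup.subset_closure ?_)) <;>
      simp only [map_sub, map_add, map_smul, FreeAbelianGroup.map_of_apply, Prod.map_apply,
        id_eq, Set.mem_setOf_eq]
    · exact Or.inl ⟨a₁, a₂, g m, rfl⟩
    · exact Or.inr (Or.inl ⟨a, g m₁, g m₂, rfl⟩)
    · exact Or.inr (Or.inr ⟨a, r, g m, rfl⟩))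

/-- Functoriality of `− ⊗_S M` : the map `A ⊗_S M → A' ⊗_S M` induced by a linear map
`f : A → A'` of right `S`-modules. -/
def lmap (M : Type u) [AddCommGroup M] [Module S M] (f : A →ₗ[Sᵐᵒᵖ] A') :
    NTensor S A M →+ NTensor S A' M :=
  QuotientAddGroup.map (tensorRels S A M) (tensorRels S A' M) (FreeAbelianGroup.map (Prod.map f id)) (by
    simp only [tensorRels]
    refine (AddSubgroup.closure_le _).2 ?_
    rintro x (⟨a₁, a₂, m, rfl⟩ | ⟨a, m₁, m₂, rfl⟩ | ⟨a, r, m, rfl⟩) <;>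
      refine SetLike.mem_coe.2 (AddSubgroup.mem_comap.2 (AddSubgroup.subset_closure ?_)) <;>
      simp only [map_sub, map_add, map_smul, FreeAbelianGroup.map_of_apply, Prod.map_apply,
        id_eq, Set.mem_setOf_eq]
    · exact Or.inl ⟨f a₁, f a₂, m, rfl⟩
    · exact Or.inr (Or.inl ⟨f a, m₁, m₂, rfl⟩)
    · exact Or.inr (Or.inr ⟨f a, r, m, rfl⟩))

end NTensor

end Tensor

section Dims

variable (S : Type u) [Ring S]

/-- A left `S`-module `M` is *flat* if tensoring with it preserves injectivity of maps of
right `S`-modules. -/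
def IsFlatMod (M : ModuleCat.{u} S) : Prop :=
  ∀ (A B : Type u) [AddCommGroup A] [Module Sᵐᵒᵖ A] [AddCommGroup B] [Module Sᵐᵒᵖ B]
    (f : A →ₗ[Sᵐᵒᵖ] B), Function.Injective f →
      Function.Injective (NTensor.lmap (↥M) f)

/-- A left `S`-module `M` is *Gorenstein flat* if there is an exact sequence
`⋯ → F (-1) → F 0 → F 1 → ⋯` of flat left `S`-modules with `M ≅ Im (F 0 → F 1)` which stays
exact after applying `I ⊗_S −` for every injective right `S`-module `I`
(a *complete flat resolution*). -/
def IsGorensteinFlat (M : ModuleCat.{u} S) : Prop :=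
  ∃ (F : ℤ → ModuleCat.{u} S) (d : ∀ n : ℤ, ↥(F n) →ₗ[S] ↥(F (n + 1))),
    (∀ n, IsFlatMod S (F n)) ∧
    (∀ n, Function.Exact (d n) (d (n + 1))) ∧
    Nonempty (↥M ≃ₗ[S] ↥(LinearMap.range (d 0))) ∧
    (∀ (I : Type u) [AddCommGroup I] [Module Sᵐᵒᵖ I], Module.Injective Sᵐᵒᵖ I →
      ∀ n, Function.Exact (NTensor.rmap I (d n)) (NTensor.rmap I (d (n + 1))))

/-- `gflatDimLE S n M` means `Gfd_S(M) ≤ n`: there is an exact sequence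
`0 → G_n → ⋯ → G_0 → M → 0` of left `S`-modules with all `G_i` Gorenstein flat. -/
def gflatDimLE : ℕ → ModuleCat.{u} S → Prop
  | 0, M => IsGorensteinFlat S M
  | n + 1, M => ∃ (K G : ModuleCat.{u} S) (ι : ↥K →ₗ[S] ↥G) (π : ↥G →ₗ[S] ↥M),
      Function.Injective ι ∧ Function.Surjective π ∧ Function.Exact ι π ∧
      IsGorensteinFlat S G ∧ gflatDimLE n K

/-- `flatDimLE S n M` means `fd_S(M) ≤ n`: there is an exact sequence
`0 → F_n → ⋯ → F_0 → M → 0` of left `S`-modules with all `F_i` flat. -/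
def flatDimLE : ℕ → ModuleCat.{u} S → Prop
  | 0, M => IsFlatMod S M
  | n + 1, M => ∃ (K F : ModuleCat.{u} S) (ι : ↥K →ₗ[S] ↥F) (π : ↥F →ₗ[S] ↥M),
      Function.Injective ι ∧ Function.Surjective π ∧ Function.Exact ι π ∧
      IsFlatMod S F ∧ flatDimLE n K

/-- `injDimLE S n M` means `id_S(M) ≤ n`: there is an exact sequence
`0 → M → I^0 → ⋯ → I^n → 0` of left `S`-modules with all `I^i` injective. -/
def injDimLE : ℕ → ModuleCat.{u} S → Prop
  | 0, M => Module.Injective S ↥M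
  | n + 1, M => ∃ (I C : ModuleCat.{u} S) (ι : ↥M →ₗ[S] ↥I) (π : ↥I →ₗ[S] ↥C),
      Function.Injective ι ∧ Function.Surjective π ∧ Function.Exact ι π ∧
      Module.Injective S ↥I ∧ injDimLE n C

/-- The Gorenstein flat dimension `Gfd_S(M) ∈ ℕ∞` of a left `S`-module `M`. -/
noncomputable def gflatDim (M : ModuleCat.{u} S) : ℕ∞ :=
  sInf {d : ℕ∞ | ∃ n : ℕ, d = n ∧ gflatDimLE S n M}

/-- The flat dimension `fd_S(M) ∈ ℕ∞` of a left `S`-module `M`. -/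
noncomputable def flatDim (M : ModuleCat.{u} S) : ℕ∞ :=
  sInf {d : ℕ∞ | ∃ n : ℕ, d = n ∧ flatDimLE S n M}

/-- The injective dimension `id_S(M) ∈ ℕ∞` of a left `S`-module `M`. -/
noncomputable def injDim (M : ModuleCat.{u} S) : ℕ∞ :=
  sInf {d : ℕ∞ | ∃ n : ℕ, d = n ∧ injDimLE S n M}

/-- The left weak Gorenstein global dimension
`l.Gwdim(S) = sup { Gfd_S(M) | M a left S-module }`.  The right weak Gorenstein global
dimension of `S` is `gorensteinWeakGlobalDim Sᵐᵒᵖ`. -/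
noncomputable def gorensteinWeakGlobalDim : ℕ∞ :=
  ⨆ M : ModuleCat.{u} S, gflatDim S M

/-- The left weak global dimension `sup { fd_S(M) | M a left S-module }`.  (By a classical
theorem it agrees with `weakGlobalDim Sᵐᵒᵖ`, and the common value is `wdim S`.) -/
noncomputable def weakGlobalDim : ℕ∞ :=
  ⨆ M : ModuleCat.{u} S, flatDim S M

/-- The left finitistic flat dimension
`l.FFD(S) = sup { fd_S(M) | M a left S-module with fd_S(M) < ∞ }`. -/
noncomputable def finitisticFlatDim : ℕ∞ :=
  sSup {d : ℕ∞ | d ≠ ⊤ ∧ ∃ M : ModuleCat.{u} S, flatDim S M = d}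

/-- The left finitistic Gorenstein flat dimension
`l.FGFD(S) = sup { Gfd_S(M) | M a left S-module with Gfd_S(M) < ∞ }`. -/
noncomputable def finitisticGFlatDim : ℕ∞ :=
  sSup {d : ℕ∞ | d ≠ ⊤ ∧ ∃ M : ModuleCat.{u} S, gflatDim S M = d}

/-- A ring `S` is *left GF-closed* if the class of Gorenstein flat left `S`-modules is closed
under extensions.  `S` is right GF-closed iff `Sᵐᵒᵖ` is left GF-closed, and GF-closed if both. -/
def IsGFClosed : Prop :=
  ∀ (A B C : ModuleCat.{u} S) (f : ↥A →ₗ[S] ↥B) (g : ↥B →ₗ[S] ↥C),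
    Function.Injective f → Function.Surjective g → Function.Exact f g →
      IsGorensteinFlat S A → IsGorensteinFlat S C → IsGorensteinFlat S B

/-- A ring `S` is *left coherent* if every finitely generated left ideal of `S` is finitely
presented (as a left `S`-module).  `S` is right coherent iff `Sᵐᵒᵖ` is left coherent. -/
def IsLeftCoherent : Prop :=
  ∀ I : Submodule S S, I.FG → Module.FinitePresentation S ↥I

/-- A ring `S` is *left IF* if every injective left `S`-module is flat.  `S` is right IF iff
`Sᵐᵒᵖ` is left IF, and IF if both. -/
def IsLeftIF : Prop :=
  ∀ E : ModuleCat.{u} S, Module.Injective S ↥E → IsFlatMod S E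

/-- A ring `S` is *left `n`-IF* if `fd_S(E) ≤ n` for every injective left `S`-module `E`.
`S` is right `n`-IF iff `Sᵐᵒᵖ` is left `n`-IF, and `n`-IF if both. -/
def IsLeftNIF (n : ℕ) : Prop :=
  ∀ E : ModuleCat.{u} S, Module.Injective S ↥E → flatDim S E ≤ (n : ℕ∞)

/-- `Ext¹_S(T, K) = 0`, expressed by its standard characterization: every extension of `T`
by `K` (i.e. every short exact sequence `0 → K → X → T → 0`) splits. -/
def Ext1Zero (T K : ModuleCat.{u} S) : Prop :=
  ∀ (X : ModuleCat.{u} S) (ι : ↥K →ₗ[S] ↥X) (π : ↥X →ₗ[S] ↥T),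
    Function.Injective ι → Function.Surjective π → Function.Exact ι π →
      ∃ ρ : ↥X →ₗ[S] ↥K, ρ.comp ι = LinearMap.id

/-- A left `S`-module `K` is *cotorsion* if `Ext¹_S(F, K) = 0` for every flat left
`S`-module `F`. -/
def IsCotorsion (K : ModuleCat.{u} S) : Prop :=
  ∀ F : ModuleCat.{u} S, IsFlatMod S F → Ext1Zero S F K

/-- `Tor₁^S(A, T) = 0` for a right `S`-module `A` and a left `S`-module `T`, expressed by its
standard characterization: for every short exact sequence `0 → K → F → T → 0` of left
`S`-modules with `F` flat, the induced map `A ⊗_S K → A ⊗_S F` is injective. -/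
def Tor1Zero (A : Type u) [AddCommGroup A] [Module Sᵐᵒᵖ A] (T : ModuleCat.{u} S) : Prop :=
  ∀ (K F : ModuleCat.{u} S) (ι : ↥K →ₗ[S] ↥F) (π : ↥F →ₗ[S] ↥T),
    IsFlatMod S F → Function.Injective ι → Function.Surjective π → Function.Exact ι π →
      Function.Injective (NTensor.rmap A ι)

/-- A left `S`-module is *finitely presented* if it admits a presentation with finitely many
generators and relations. -/
abbrev IsFinitelyPresented (M : ModuleCat.{u} S) : Prop :=
  Module.FinitePresentation S ↥M

end Dims

namespace NTensor

section Basic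

variable {S : Type u} [Ring S]
variable {A A' A'' : Type u} [AddCommGroup A] [Module Sᵐᵒᵖ A] [AddCommGroup A'] [Module Sᵐᵒᵖ A']
  [AddCommGroup A''] [Module Sᵐᵒᵖ A'']
variable {M M' M'' : Type u} [AddCommGroup M] [Module S M] [AddCommGroup M'] [Module S M']
  [AddCommGroup M''] [Module S M'']

variable (S) in
/-- The pure tensor `a ⊗ m` in `A ⊗_S M`. -/
def tmul (a : A) (m : M) : NTensor S A M :=
  QuotientAddGroup.mk' (tensorRels S A M) (FreeAbelianGroup.of (a, m))

theorem add_tmul (a₁ a₂ : A) (m : M) : tmul S (a₁ + a₂) m = tmul S a₁ m + tmul S a₂ m := by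
  have h : FreeAbelianGroup.of (a₁ + a₂, m) - FreeAbelianGroup.of (a₁, m) -
      FreeAbelianGroup.of (a₂, m) ∈ tensorRels S A M :=
    AddSubgroup.subset_closure (Or.inl ⟨a₁, a₂, m, rfl⟩)
  have hq := (QuotientAddGroup.eq_zero_iff _).2 h
  rw [← QuotientAddGroup.mk'_apply, map_sub, map_sub, sub_sub, sub_eq_zero] at hq
  exact hq

theorem tmul_add (a : A) (m₁ m₂ : M) : tmul S a (m₁ + m₂) = tmul S a m₁ + tmul S a m₂ := by
  have h : FreeAbelianGroup.of (a, m₁ + m₂) - FreeAbelianGroup.of (a, m₁) -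
      FreeAbelianGroup.of (a, m₂) ∈ tensorRels S A M :=
    AddSubgroup.subset_closure (Or.inr (Or.inl ⟨a, m₁, m₂, rfl⟩))
  have hq := (QuotientAddGroup.eq_zero_iff _).2 h
  rw [← QuotientAddGroup.mk'_apply, map_sub, map_sub, sub_sub, sub_eq_zero] at hq
  exact hq

theorem smul_tmul (r : S) (a : A) (m : M) : tmul S (op r • a) m = tmul S a (r • m) := by
  have h : FreeAbelianGroup.of (op r • a, m) - FreeAbelianGroup.of (a, r • m) ∈
      tensorRels S A M :=
    AddSubgroup.subset_closure (Or.inr (Or.inr ⟨a, r, m, rfl⟩))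
  have hq := (QuotientAddGroup.eq_zero_iff _).2 h
  rw [← QuotientAddGroup.mk'_apply, map_sub, sub_eq_zero] at hq
  exact hq

variable (S) in
/-- The pure tensor as a biadditive map. -/
def tmulHom : A →+ M →+ NTensor S A M :=
  AddMonoidHom.mk' (fun a => AddMonoidHom.mk' (tmul S a) (tmul_add a))
    fun a₁ a₂ => AddMonoidHom.ext fun m => add_tmul a₁ a₂ m

theorem tmulHom_apply (a : A) (m : M) : tmulHom S a m = tmul S a m := rfl

theorem tmul_zero (a : A) : tmul S a (0 : M) = 0 := map_zero (tmulHom S a)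

/-- The universal property of `A ⊗_S M` for balanced biadditive maps. -/
def lift {G : Type*} [AddCommGroup G] (f : A →+ M →+ G)
    (h : ∀ (a : A) (r : S) (m : M), f (op r • a) m = f a (r • m)) : NTensor S A M →+ G :=
  QuotientAddGroup.lift (tensorRels S A M) (FreeAbelianGroup.lift fun p => f p.1 p.2) (by
    refine (AddSubgroup.closure_le _).2 ?_
    rintro x (⟨a₁, a₂, m, rfl⟩ | ⟨a, m₁, m₂, rfl⟩ | ⟨a, r, m, rfl⟩) <;>
      simp [h])

theorem lift_tmul {G : Type*} [AddCommGroup G] (f : A →+ M →+ G)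
    (h : ∀ (a : A) (r : S) (m : M), f (op r • a) m = f a (r • m)) (a : A) (m : M) :
    lift f h (tmul S a m) = f a m :=
  FreeAbelianGroup.lift_apply_of _ _

theorem hom_ext {G : Type*} [AddCommGroup G] {f g : NTensor S A M →+ G}
    (h : ∀ a m, f (tmul S a m) = g (tmul S a m)) : f = g := by
  refine QuotientAddGroup.addMonoidHom_ext _ (FreeAbelianGroup.lift_ext _ _ fun p => ?_)
  exact h p.1 p.2

theorem rmap_tmul (g : M →ₗ[S] M') (a : A) (m : M) :
    rmap A g (tmul S a m) = tmul S a (g m) := by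
  change QuotientAddGroup.mk _ = QuotientAddGroup.mk _
  rw [FreeAbelianGroup.map_of_apply]
  rfl

theorem lmap_tmul (f : A →ₗ[Sᵐᵒᵖ] A') (a : A) (m : M) :
    lmap M f (tmul S a m) = tmul S (f a) m := by
  change QuotientAddGroup.mk _ = QuotientAddGroup.mk _
  rw [FreeAbelianGroup.map_of_apply]
  rfl

theorem rmap_comp (g : M →ₗ[S] M') (g' : M' →ₗ[S] M'') (t : NTensor S A M) :
    rmap A g' (rmap A g t) = rmap A (g'.comp g) t := by
  have h : (rmap A g').comp (rmap A g) = rmap A (g'.comp g) :=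
    hom_ext fun a m => by simp [rmap_tmul]
  exact DFunLike.congr_fun h t

theorem rmap_id (t : NTensor S A M) : rmap A LinearMap.id t = t := by
  have h : rmap A (LinearMap.id : M →ₗ[S] M) = AddMonoidHom.id _ :=
    hom_ext fun a m => by simp [rmap_tmul]
  exact DFunLike.congr_fun h t

theorem rmap_zero (t : NTensor S A M) : rmap A (0 : M →ₗ[S] M') t = 0 := by
  have h : rmap A (0 : M →ₗ[S] M') = 0 :=
    hom_ext fun a m => by simp [rmap_tmul, tmul_zero]
  exact DFunLike.congr_fun h t

theorem rmap_add (g g' : M →ₗ[S] M') (t : NTensor S A M) :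
    rmap A (g + g') t = rmap A g t + rmap A g' t := by
  have h : rmap A (g + g') = rmap A g + rmap A g' :=
    hom_ext fun a m => by simp [rmap_tmul, tmul_add]
  exact DFunLike.congr_fun h t

theorem lmap_rmap (f : A →ₗ[Sᵐᵒᵖ] A') (g : M →ₗ[S] M') (t : NTensor S A M) :
    lmap M' f (rmap A g t) = rmap A' g (lmap M f t) := by
  have h : (lmap M' f).comp (rmap A g) = (rmap A' g).comp (lmap M f) :=
    hom_ext fun a m => by simp [rmap_tmul, lmap_tmul]
  exact DFunLike.congr_fun h t

theorem rmap_rightExact (A : Type u) [AddCommGroup A] [Module Sᵐᵒᵖ A] {g : M →ₗ[S] M'}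
    {g' : M' →ₗ[S] M''} (he : Function.Exact g g') (hs : Function.Surjective g') :
    Function.Exact (rmap A g) (rmap A g') ∧ Function.Surjective (rmap A g') := by
  let q := QuotientAddGroup.mk' (rmap A g).range
  have hq : ∀ (a : A) (x y : M'), g' x = g' y → q (tmul S a x) = q (tmul S a y) := by
    intro a x y hxy
    obtain ⟨z, hz⟩ := (he (x - y)).1 (by rw [map_sub, hxy, sub_self])
    have hx : x = g z + y := by rw [hz, sub_add_cancel]
    have h0 : q (tmul S a (g z)) = 0 :=
      (QuotientAddGroup.eq_zero_iff _).2 ⟨tmul S a z, rmap_tmul g a z⟩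
    rw [hx, tmul_add, map_add, h0, zero_add]
  have hr := Function.surjInv_eq hs
  let σ : NTensor S A M'' →+ NTensor S A M' ⧸ (rmap A g).range :=
    lift (AddMonoidHom.mk' (fun a => AddMonoidHom.mk'
      (fun m => q (tmul S a (Function.surjInv hs m)))
      fun m₁ m₂ => by
        rw [← map_add, ← tmul_add]
        exact hq _ _ _ (by rw [map_add, hr, hr, hr]))
      fun a₁ a₂ => AddMonoidHom.ext fun m => by simp [add_tmul]) fun a r m => by
        change q _ = q _
        rw [smul_tmul]
        exact hq _ _ _ (by rw [map_smul, hr, hr])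
  have hσ : σ.comp (rmap A g') = q := hom_ext fun a m => by
    rw [AddMonoidHom.comp_apply, rmap_tmul, lift_tmul]
    exact hq _ _ _ (hr _)
  refine ⟨fun t => ⟨fun ht => ?_, ?_⟩, fun t => ?_⟩
  · have h := DFunLike.congr_fun hσ t
    rw [AddMonoidHom.comp_apply, ht, map_zero] at h
    exact (QuotientAddGroup.eq_zero_iff _).1 h.symm
  · rintro ⟨s, rfl⟩
    rw [rmap_comp, he.linearMap_comp_eq_zero, rmap_zero]
  · let ρ : NTensor S A M'' →+ NTensor S A M'' ⧸ (rmap A g').range :=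
      QuotientAddGroup.mk' _
    have h : ρ = 0 := hom_ext fun a m => (QuotientAddGroup.eq_zero_iff _).2
      ⟨tmul S a (Function.surjInv hs m), by rw [rmap_tmul, hr]⟩
    exact (QuotientAddGroup.eq_zero_iff _).1 (DFunLike.congr_fun h t)

end Basic

section Swap

variable {S : Type u} [Ring S]
variable {A A' : Type u} [AddCommGroup A] [Module Sᵐᵒᵖ A] [AddCommGroup A'] [Module Sᵐᵒᵖ A']
variable {M M' : Type u} [AddCommGroup M] [Module S M] [Module Sᵐᵒᵖᵐᵒᵖ M]
  [AddCommGroup M'] [Module S M'] [Module Sᵐᵒᵖᵐᵒᵖ M']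

/-- The map `A ⊗_S M → M ⊗_{Sᵐᵒᵖ} A` exchanging the factors, for a module `M` over `S` and over
`Sᵐᵒᵖᵐᵒᵖ` with compatible actions. -/
def swapHom (A : Type u) [AddCommGroup A] [Module Sᵐᵒᵖ A]
    (h : ∀ (r : S) (m : M), op (op r) • m = r • m) : NTensor S A M →+ NTensor Sᵐᵒᵖ M A :=
  lift (S := S) (A := A) (M := M) (tmulHom (A := M) (M := A) Sᵐᵒᵖ).flip fun a r m => by
    rw [AddMonoidHom.flip_apply, AddMonoidHom.flip_apply, tmulHom_apply, tmulHom_apply,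
      ← smul_tmul, h]

theorem swapHom_tmul (h : ∀ (r : S) (m : M), op (op r) • m = r • m) (a : A) (m : M) :
    swapHom A h (tmul S a m) = tmul Sᵐᵒᵖ m a :=
  lift_tmul (S := S) (A := A) (M := M) _ _ a m

/-- The inverse of `NTensor.swapHom`. -/
def swapInv (A : Type u) [AddCommGroup A] [Module Sᵐᵒᵖ A]
    (h : ∀ (r : S) (m : M), op (op r) • m = r • m) : NTensor Sᵐᵒᵖ M A →+ NTensor S A M :=
  lift (S := Sᵐᵒᵖ) (A := M) (M := A) (tmulHom (A := A) (M := M) S).flip fun m r a => by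
    rw [AddMonoidHom.flip_apply, AddMonoidHom.flip_apply, tmulHom_apply, tmulHom_apply,
      ← op_unop r, h, smul_tmul]

theorem swapInv_tmul (h : ∀ (r : S) (m : M), op (op r) • m = r • m) (a : A) (m : M) :
    swapInv A h (tmul Sᵐᵒᵖ m a) = tmul S a m :=
  lift_tmul (S := Sᵐᵒᵖ) (A := M) (M := A) _ _ m a

/-- The isomorphism `A ⊗_S M ≃ M ⊗_{Sᵐᵒᵖ} A`, for a module `M` over `S` and over `Sᵐᵒᵖᵐᵒᵖ`
with compatible actions. -/
def swap (A : Type u) [AddCommGroup A] [Module Sᵐᵒᵖ A]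
    (h : ∀ (r : S) (m : M), op (op r) • m = r • m) : NTensor S A M ≃+ NTensor Sᵐᵒᵖ M A :=
  AddMonoidHom.toAddEquiv (swapHom A h) (swapInv A h)
    (hom_ext fun a m => by
      rw [AddMonoidHom.comp_apply, swapHom_tmul, swapInv_tmul, AddMonoidHom.id_apply])
    (hom_ext fun m a => by
      rw [AddMonoidHom.comp_apply, swapInv_tmul, swapHom_tmul, AddMonoidHom.id_apply])

theorem swap_tmul (h : ∀ (r : S) (m : M), op (op r) • m = r • m) (a : A) (m : M) :
    swap A h (tmul S a m) = tmul Sᵐᵒᵖ m a :=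
  swapHom_tmul h a m

theorem swap_lmap (h : ∀ (r : S) (m : M), op (op r) • m = r • m) (f : A →ₗ[Sᵐᵒᵖ] A')
    (t : NTensor S A M) : swap A' h (lmap M f t) = rmap M f (swap A h t) := by
  have H : (swap A' h).toAddMonoidHom.comp (lmap M f) =
      (rmap M f).comp (swap A h).toAddMonoidHom :=
    hom_ext fun a m => by simp [lmap_tmul, rmap_tmul, swap_tmul]
  exact DFunLike.congr_fun H t

theorem swap_rmap (h : ∀ (r : S) (m : M), op (op r) • m = r • m)
    (h' : ∀ (r : S) (m : M'), op (op r) • m = r • m) (g : M →ₗ[S] M')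
    (g' : M →ₗ[Sᵐᵒᵖᵐᵒᵖ] M') (hg : ∀ m, g' m = g m)
    (t : NTensor S A M) : swap A h' (rmap A g t) = lmap A g' (swap A h t) := by
  have H : (swap A h').toAddMonoidHom.comp (rmap A g) =
      (lmap A g').comp (swap A h).toAddMonoidHom :=
    hom_ext fun a m => by simp [lmap_tmul, rmap_tmul, swap_tmul, hg]
  exact DFunLike.congr_fun H t

end Swap

section RightExact

variable {S : Type u} [Ring S]
variable {A A' A'' : Type u} [AddCommGroup A] [Module Sᵐᵒᵖ A] [AddCommGroup A'] [Module Sᵐᵒᵖ A']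
  [AddCommGroup A''] [Module Sᵐᵒᵖ A'']

theorem lmap_rightExact (M : Type u) [AddCommGroup M] [Module S M] {f : A →ₗ[Sᵐᵒᵖ] A'}
    {f' : A' →ₗ[Sᵐᵒᵖ] A''} (he : Function.Exact f f') (hs : Function.Surjective f') :
    Function.Exact (lmap M f) (lmap M f') ∧ Function.Surjective (lmap M f') := by
  let _ : Module Sᵐᵒᵖᵐᵒᵖ M := Module.compHom M (RingEquiv.opOp S).symm.toRingHom
  have h : ∀ (r : S) (m : M), op (op r) • m = r • m := fun _ _ => rfl
  obtain ⟨he', hs'⟩ := rmap_rightExact M he hs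
  refine ⟨fun t => ?_, fun t => ?_⟩
  · rw [← (swap A'' h).map_eq_zero_iff, swap_lmap, he']
    refine ⟨?_, ?_⟩
    · rintro ⟨s, hs⟩
      refine ⟨(swap A h).symm s, (swap A' h).injective ?_⟩
      rw [swap_lmap, AddEquiv.apply_symm_apply, hs]
    · rintro ⟨s, rfl⟩
      exact ⟨swap A h s, (swap_lmap h f s).symm⟩
  · obtain ⟨s, hs⟩ := hs' (swap A'' h t)
    refine ⟨(swap A' h).symm s, (swap A'' h).injective ?_⟩
    rw [swap_lmap, AddEquiv.apply_symm_apply, hs]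

end RightExact

end NTensor

/-- A diagram chase in a commutative diagram with three rows and columns: under the indicated
exactness conditions the last map between the first two rows is injective. -/
theorem injective_of_three_by_three {X₁ X₂ X₃ Y₁ Y₂ Y₃ Z₁ Z₂ : Type*}
    [AddCommGroup X₁] [AddCommGroup X₂] [AddCommGroup X₃] [AddCommGroup Y₁] [AddCommGroup Y₂]
    [AddCommGroup Y₃] [AddCommGroup Z₁] [AddCommGroup Z₂]
    {a₁ : X₁ →+ X₂} {b₁ : X₂ →+ X₃} {a₂ : Y₁ →+ Y₂} {b₂ : Y₂ →+ Y₃} {a₃ : Z₁ →+ Z₂}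
    {f₁ : X₁ →+ Y₁} {f₂ : X₂ →+ Y₂} {f₃ : X₃ →+ Y₃} {g₁ : Y₁ →+ Z₁} {g₂ : Y₂ →+ Z₂}
    (h₁₁ : ∀ x, f₂ (a₁ x) = a₂ (f₁ x)) (h₁₂ : ∀ x, f₃ (b₁ x) = b₂ (f₂ x))
    (h₂₁ : ∀ y, g₂ (a₂ y) = a₃ (g₁ y))
    (e₁ : Function.Exact a₁ b₁) (hb₁ : Function.Surjective b₁) (e₂ : Function.Exact a₂ b₂)
    (c₁ : Function.Exact f₁ g₁) (c₂ : Function.Exact f₂ g₂)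
    (hf₂ : Function.Injective f₂) (ha₃ : Function.Injective a₃) : Function.Injective f₃ := by
  rw [injective_iff_map_eq_zero]
  intro x hx
  obtain ⟨x, rfl⟩ := hb₁ x
  rw [h₁₂, e₂] at hx
  obtain ⟨y, hy⟩ := hx
  have hgy : g₁ y = 0 := ha₃ (by rw [← h₂₁, hy, c₂.apply_apply_eq_zero, map_zero])
  obtain ⟨z, rfl⟩ := (c₁ y).1 hgy
  rw [← h₁₁] at hy
  rw [← hf₂ hy, e₁.apply_apply_eq_zero]

section Flat

open NTensor

theorem isFlatMod_finsupp (S : Type u) [Ring S] (X : Type u) :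
    IsFlatMod S (ModuleCat.of S (X →₀ S)) := by
  intro A B _ _ _ _ f hf
  have key : ∀ (A : Type u) [AddCommGroup A] [Module Sᵐᵒᵖ A],
      ∃ φ : NTensor S A (X →₀ S) →+ (X →₀ A), Function.Injective φ ∧
        ∀ a x, φ (tmul S a x) = x.mapRange (fun r => op r • a) (by simp) := by
    intro A _ _
    let φ : NTensor S A (X →₀ S) →+ (X →₀ A) :=
      lift (AddMonoidHom.mk' (fun a => AddMonoidHom.mk'
        (fun x : X →₀ S => x.mapRange (fun r => op r • a) (by simp))
        fun x y => by ext; simp [add_smul]) fun a b => by ext; simp) fun a r x => by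
          ext; simp [mul_smul]
    have hφ : ∀ a x, φ (tmul S a x) = x.mapRange (fun r => op r • a) (by simp) :=
      fun a x => lift_tmul _ _ a x
    let ψ : (X →₀ A) →+ NTensor S A (X →₀ S) :=
      Finsupp.liftAddHom fun i => (tmulHom S).flip (Finsupp.single i (1 : S))
    have h : ψ.comp φ = AddMonoidHom.id _ := hom_ext fun a x => by
      rw [AddMonoidHom.comp_apply, hφ, AddMonoidHom.id_apply]
      induction x using Finsupp.induction_linear with
      | zero => simp [tmul_zero]
      | add x y hx hy =>
        rw [Finsupp.mapRange_add (by simp [add_smul]), map_add, hx, hy, tmul_add]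
      | single i r =>
        simp [ψ, tmulHom_apply, smul_tmul]
    exact ⟨φ, Function.LeftInverse.injective (g := ψ) fun t => DFunLike.congr_fun h t, hφ⟩
  obtain ⟨φ, hφ, hφ'⟩ := key A
  obtain ⟨χ, -, hχ⟩ := key B
  have hc : χ.comp (lmap (X →₀ S) f) = (Finsupp.mapRange.addMonoidHom f.toAddMonoidHom).comp φ :=
    hom_ext fun a x => by ext; simp [lmap_tmul, hφ', hχ]
  refine Function.Injective.of_comp (f := χ) ?_
  rw [← AddMonoidHom.coe_comp]
  change Function.Injective (χ.comp (lmap (X →₀ S) f))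
  rw [hc]
  exact (Finsupp.mapRange_injective f (map_zero f) hf).comp hφ

/-- Flatness of a right module, in terms of the tensor product functor on left modules. -/
theorem isFlatMod_op_iff {R : Type u} [Ring R] (A : ModuleCat.{u} Rᵐᵒᵖ) :
    IsFlatMod Rᵐᵒᵖ A ↔ ∀ (M N : Type u) [AddCommGroup M] [Module R M] [AddCommGroup N]
      [Module R N] (g : M →ₗ[R] N), Function.Injective g → Function.Injective (rmap A g) := by
  constructor
  · intro h M N _ _ _ _ g hg
    let _ : Module Rᵐᵒᵖᵐᵒᵖ M := Module.compHom M (RingEquiv.opOp R).symm.toRingHom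
    let _ : Module Rᵐᵒᵖᵐᵒᵖ N := Module.compHom N (RingEquiv.opOp R).symm.toRingHom
    have hM : ∀ (r : R) (m : M), op (op r) • m = r • m := fun _ _ => rfl
    have hN : ∀ (r : R) (m : N), op (op r) • m = r • m := fun _ _ => rfl
    let g' : M →ₗ[Rᵐᵒᵖᵐᵒᵖ] N :=
      { toFun := g, map_add' := map_add g, map_smul' := fun r m => map_smul g r.unop.unop m }
    have H := (h M N g' hg).comp (swap A hM).injective
    refine Function.Injective.of_comp (f := swap A hN) ?_
    convert H using 1
    exact funext fun t => swap_rmap hM hN g g' (fun _ => rfl) t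
  · intro h M N _ _ _ _ g hg
    let _ : Module R M := Module.compHom M (RingEquiv.opOp R).toRingHom
    let _ : Module R N := Module.compHom N (RingEquiv.opOp R).toRingHom
    have hM : ∀ (r : R) (m : M), op (op r) • m = r • m := fun _ _ => rfl
    have hN : ∀ (r : R) (m : N), op (op r) • m = r • m := fun _ _ => rfl
    let g' : M →ₗ[R] N :=
      { toFun := g, map_add' := map_add g, map_smul' := fun r m => map_smul g (op (op r)) m }
    have H := (swap A hN).injective.comp (h M N g' hg)
    refine Function.Injective.of_comp_right (g := swap A hM) ?_ (swap A hM).surjective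
    convert H using 1
    exact funext fun t => (swap_rmap hM hN g' g (fun _ => rfl) t).symm

theorem IsFlatMod.of_linearEquiv {S : Type u} [Ring S] {M N : ModuleCat.{u} S}
    (h : IsFlatMod S N) (e : M ≃ₗ[S] N) : IsFlatMod S M := by
  intro A B _ _ _ _ f hf
  have hinj : Function.Injective (rmap A e.toLinearMap) :=
    Function.LeftInverse.injective (g := rmap A e.symm.toLinearMap) fun t => by
      rw [rmap_comp, LinearEquiv.symm_comp, rmap_id]
  refine Function.Injective.of_comp (f := rmap B e.toLinearMap) ?_
  convert (h A B f hf).comp hinj using 1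
  exact funext fun t => (lmap_rmap f e.toLinearMap t).symm

end Flat

section Tor

open NTensor

variable {R : Type u} [Ring R]

theorem lmap_injective_of_rmap_injective {L P A : Type u} [AddCommGroup L] [Module Rᵐᵒᵖ L]
    [AddCommGroup P] [Module Rᵐᵒᵖ P] [AddCommGroup A] [Module Rᵐᵒᵖ A]
    {K F M : Type u} [AddCommGroup K] [Module R K] [AddCommGroup F] [Module R F]
    [AddCommGroup M] [Module R M] {f : L →ₗ[Rᵐᵒᵖ] P} {g : P →ₗ[Rᵐᵒᵖ] A}
    {ι : K →ₗ[R] F} {π : F →ₗ[R] M} (hfg : Function.Exact f g) (hg : Function.Surjective g)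
    (hιπ : Function.Exact ι π) (hπ : Function.Surjective π)
    (hF : Function.Injective (lmap F f)) (hA : Function.Injective (rmap A ι)) :
    Function.Injective (lmap M f) :=
  injective_of_three_by_three (a₁ := rmap L ι) (b₁ := rmap L π) (a₂ := rmap P ι)
    (b₂ := rmap P π) (a₃ := rmap A ι) (f₁ := lmap K f) (f₂ := lmap F f) (g₁ := lmap K g)
    (g₂ := lmap F g) (lmap_rmap f ι) (lmap_rmap f π) (lmap_rmap g ι)
    (rmap_rightExact L hιπ hπ).1 (rmap_rightExact L hιπ hπ).2 (rmap_rightExact P hιπ hπ).1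
    (lmap_rightExact K hfg hg).1 (lmap_rightExact F hfg hg).1 hF hA

theorem rmap_injective_of_lmap_injective {L P A : Type u} [AddCommGroup L] [Module Rᵐᵒᵖ L]
    [AddCommGroup P] [Module Rᵐᵒᵖ P] [AddCommGroup A] [Module Rᵐᵒᵖ A]
    {K F M : Type u} [AddCommGroup K] [Module R K] [AddCommGroup F] [Module R F]
    [AddCommGroup M] [Module R M] {f : L →ₗ[Rᵐᵒᵖ] P} {g : P →ₗ[Rᵐᵒᵖ] A}
    {ι : K →ₗ[R] F} {π : F →ₗ[R] M} (hfg : Function.Exact f g) (hg : Function.Surjective g)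
    (hιπ : Function.Exact ι π) (hπ : Function.Surjective π)
    (hP : Function.Injective (rmap P ι)) (hM : Function.Injective (lmap M f)) :
    Function.Injective (rmap A ι) :=
  injective_of_three_by_three (a₁ := lmap K f) (b₁ := lmap K g) (a₂ := lmap F f)
    (b₂ := lmap F g) (a₃ := lmap M f) (f₁ := rmap L ι) (f₂ := rmap P ι) (g₁ := rmap L π)
    (g₂ := rmap P π) (fun t => (lmap_rmap f ι t).symm) (fun t => (lmap_rmap g ι t).symm)
    (fun t => (lmap_rmap f π t).symm)
    (lmap_rightExact K hfg hg).1 (lmap_rightExact K hfg hg).2 (lmap_rightExact F hfg hg).1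
    (rmap_rightExact L hιπ hπ).1 (rmap_rightExact P hιπ hπ).1 hP hM

/-- The free module on the elements of `M`. -/
noncomputable def freeModule {S : Type u} [Ring S] (M : ModuleCat.{u} S) : ModuleCat.{u} S :=
  ModuleCat.of S (M →₀ S)

theorem isFlatMod_freeModule {S : Type u} [Ring S] (M : ModuleCat.{u} S) :
    IsFlatMod S (freeModule M) :=
  isFlatMod_finsupp S M

/-- The canonical surjection from the free module on the elements of `M` onto `M`. -/
noncomputable def freeCover {S : Type u} [Ring S] (M : ModuleCat.{u} S) : freeModule M →ₗ[S] M :=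
  (Finsupp.linearCombination S id : (M →₀ S) →ₗ[S] M)

theorem freeCover_surjective {S : Type u} [Ring S] (M : ModuleCat.{u} S) :
    Function.Surjective (freeCover M) :=
  Finsupp.linearCombination_id_surjective S M

/-- The kernel of the canonical free cover of `M`. -/
noncomputable def syzygy {S : Type u} [Ring S] (M : ModuleCat.{u} S) : ModuleCat.{u} S :=
  ModuleCat.of S (LinearMap.ker (freeCover M))

/-- The inclusion of the syzygy of `M` into the canonical free cover. -/
noncomputable def syzygyInclusion {S : Type u} [Ring S] (M : ModuleCat.{u} S) :
    syzygy M →ₗ[S] freeModule M :=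
  (LinearMap.ker (freeCover M)).subtype

theorem syzygyInclusion_injective {S : Type u} [Ring S] (M : ModuleCat.{u} S) :
    Function.Injective (syzygyInclusion M) :=
  Submodule.injective_subtype (LinearMap.ker (freeCover M))

theorem exact_syzygyInclusion_freeCover {S : Type u} [Ring S] (M : ModuleCat.{u} S) :
    Function.Exact (syzygyInclusion M) (freeCover M) :=
  LinearMap.exact_subtype_ker_map (freeCover M)

theorem rmap_freeModule_injective (A : ModuleCat.{u} Rᵐᵒᵖ) {M N : Type u} [AddCommGroup M]
    [Module R M] [AddCommGroup N] [Module R N] {g : M →ₗ[R] N} (hg : Function.Injective g) :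
    Function.Injective (rmap (freeModule A) g) :=
  (isFlatMod_op_iff _).1 (isFlatMod_freeModule A) M N g hg

/-- `Tor₁(A, M) = 0`, computed with the canonical free cover of the right module `A`. -/
def TorOneVanishes (A : ModuleCat.{u} Rᵐᵒᵖ) (M : ModuleCat.{u} R) : Prop :=
  Function.Injective (lmap M (syzygyInclusion A))

theorem torOneVanishes_iff (A : ModuleCat.{u} Rᵐᵒᵖ) {K F M : ModuleCat.{u} R}
    {ι : K →ₗ[R] F} {π : F →ₗ[R] M} (hι : Function.Injective ι) (hπ : Function.Surjective π)
    (he : Function.Exact ι π) (hF : IsFlatMod R F) :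
    TorOneVanishes A M ↔ Function.Injective (rmap A ι) :=
  ⟨fun h => rmap_injective_of_lmap_injective (exact_syzygyInclusion_freeCover A)
    (freeCover_surjective A)
    he hπ (rmap_freeModule_injective A hι) h,
  fun h => lmap_injective_of_rmap_injective (exact_syzygyInclusion_freeCover A)
    (freeCover_surjective A)
    he hπ (hF _ _ (syzygyInclusion A) (syzygyInclusion_injective A)) h⟩

theorem isFlatMod_iff_torOneVanishes (M : ModuleCat.{u} R) :
    IsFlatMod R M ↔ ∀ A : ModuleCat.{u} Rᵐᵒᵖ, TorOneVanishes A M := by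
  refine ⟨fun h A => h _ _ (syzygyInclusion A) (syzygyInclusion_injective A),
    fun h L P _ _ _ _ f hf => ?_⟩
  have hA := (torOneVanishes_iff
    (ModuleCat.of Rᵐᵒᵖ (P ⧸ LinearMap.range f)) (syzygyInclusion_injective M)
    (freeCover_surjective M) (exact_syzygyInclusion_freeCover M) (isFlatMod_freeModule M)).1 (h _)
  exact lmap_injective_of_rmap_injective (LinearMap.exact_map_mkQ_range f)
    (Submodule.mkQ_surjective _) (exact_syzygyInclusion_freeCover M) (freeCover_surjective M)
    (isFlatMod_freeModule M _ _ f hf) hA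

theorem isFlatMod_op_iff_torOneVanishes (A : ModuleCat.{u} Rᵐᵒᵖ) :
    IsFlatMod Rᵐᵒᵖ A ↔ ∀ M : ModuleCat.{u} R, TorOneVanishes A M := by
  rw [isFlatMod_op_iff]
  refine ⟨fun h M => ?_, fun h K F _ _ _ _ ι hι => ?_⟩
  · exact (torOneVanishes_iff A
      (syzygyInclusion_injective M) (freeCover_surjective M) (exact_syzygyInclusion_freeCover M)
      (isFlatMod_freeModule M)).2 (h _ _ _ (syzygyInclusion_injective M))
  · exact rmap_injective_of_lmap_injective (exact_syzygyInclusion_freeCover A)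
      (freeCover_surjective A)
      (LinearMap.exact_map_mkQ_range ι) (Submodule.mkQ_surjective _)
      (rmap_freeModule_injective A hι) (h (ModuleCat.of R (F ⧸ LinearMap.range ι)))

/-- Dimension shifting: `Tor₂(A, M) = 0` computed by a syzygy of `A` or of `M`. -/
theorem torOneVanishes_syzygy_iff (A : ModuleCat.{u} Rᵐᵒᵖ) {K F M : ModuleCat.{u} R}
    {ι : K →ₗ[R] F} {π : F →ₗ[R] M} (hι : Function.Injective ι) (hπ : Function.Surjective π)
    (he : Function.Exact ι π) (hF : IsFlatMod R F) :
    TorOneVanishes (syzygy A) M ↔ TorOneVanishes A K := by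
  rw [torOneVanishes_iff (syzygy A) hι hπ he hF]
  have hl : Function.Injective (lmap F (syzygyInclusion A)) :=
    hF _ _ (syzygyInclusion A) (syzygyInclusion_injective A)
  have hr : Function.Injective (rmap (freeModule A) ι) := rmap_freeModule_injective A hι
  rw [TorOneVanishes, ← hl.of_comp_iff, ← hr.of_comp_iff]
  exact iff_of_eq (congrArg _ (funext fun t => lmap_rmap _ ι t))

theorem flatDimLE_iff_torOneVanishes (n : ℕ) (M : ModuleCat.{u} R) :
    flatDimLE R n M ↔ ∀ A : ModuleCat.{u} Rᵐᵒᵖ, TorOneVanishes (syzygy^[n] A) M := by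
  induction n generalizing M with
  | zero => exact isFlatMod_iff_torOneVanishes M
  | succ n ih =>
    simp only [Function.iterate_succ_apply']
    constructor
    · rintro ⟨K, F, ι, π, hι, hπ, he, hF, hK⟩ A
      exact (torOneVanishes_syzygy_iff _ hι hπ he hF).2 ((ih K).1 hK A)
    · intro h
      exact ⟨syzygy M, freeModule M, (syzygyInclusion M),
        freeCover M, syzygyInclusion_injective M, freeCover_surjective M,
        exact_syzygyInclusion_freeCover M, isFlatMod_freeModule M, (ih _).2 fun A =>
          (torOneVanishes_syzygy_iff _
            (syzygyInclusion_injective M) (freeCover_surjective M)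
            (exact_syzygyInclusion_freeCover M) (isFlatMod_freeModule M)).1 (h A)⟩

theorem flatDimLE.succ {n : ℕ} {M : ModuleCat.{u} R} (h : flatDimLE R n M) :
    flatDimLE R (n + 1) M :=
  (flatDimLE_iff_torOneVanishes _ M).2 fun A => (flatDimLE_iff_torOneVanishes n M).1 h (syzygy A)

theorem flatDimLE.mono {m n : ℕ} (hmn : m ≤ n) {M : ModuleCat.{u} R} (h : flatDimLE R m M) :
    flatDimLE R n M := by
  induction hmn with
  | refl => exact h
  | step _ ih => exact ih.succ

theorem flatDimLE.of_shortExact {n : ℕ} {K F M : ModuleCat.{u} R} (h : flatDimLE R (n + 1) M)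
    {ι : K →ₗ[R] F} {π : F →ₗ[R] M} (hι : Function.Injective ι) (hπ : Function.Surjective π)
    (he : Function.Exact ι π) (hF : IsFlatMod R F) : flatDimLE R n K := by
  rw [flatDimLE_iff_torOneVanishes] at h ⊢
  intro A
  have hA := h A
  rw [Function.iterate_succ_apply'] at hA
  exact (torOneVanishes_syzygy_iff _ hι hπ he hF).1 hA

theorem flatDimLE_iff_isFlatMod_syzygy (n : ℕ) (M : ModuleCat.{u} R) :
    flatDimLE R n M ↔ IsFlatMod R (syzygy^[n] M) := by
  induction n generalizing M with
  | zero => rfl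
  | succ n ih =>
    rw [Function.iterate_succ_apply, ← ih]
    exact ⟨fun h => h.of_shortExact (syzygyInclusion_injective M) (freeCover_surjective M)
      (exact_syzygyInclusion_freeCover M) (isFlatMod_freeModule M), fun h =>
      ⟨syzygy M, freeModule M, (syzygyInclusion M), freeCover M,
        syzygyInclusion_injective M, freeCover_surjective M, exact_syzygyInclusion_freeCover M,
        isFlatMod_freeModule M, h⟩⟩

theorem forall_flatDimLE_iff_op (n : ℕ) :
    (∀ M : ModuleCat.{u} R, flatDimLE R n M) ↔ ∀ A : ModuleCat.{u} Rᵐᵒᵖ, flatDimLE Rᵐᵒᵖ n A := by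
  simp only [flatDimLE_iff_isFlatMod_syzygy (R := Rᵐᵒᵖ), isFlatMod_op_iff_torOneVanishes,
    flatDimLE_iff_torOneVanishes (R := R)]
  exact forall_comm

theorem flatDim_le_iff (n : ℕ) (M : ModuleCat.{u} R) :
    flatDim R M ≤ n ↔ flatDimLE R n M := by
  refine ⟨fun h => ?_, fun h => sInf_le ⟨n, rfl, h⟩⟩
  have hne : {d : ℕ∞ | ∃ n : ℕ, d = n ∧ flatDimLE R n M}.Nonempty := by
    by_contra hempty
    rw [Set.not_nonempty_iff_eq_empty] at hempty
    rw [flatDim, hempty, sInf_empty] at h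
    exact ENat.natCast_ne_top n (top_le_iff.1 h)
  obtain ⟨m, hm, hM⟩ := csInf_mem hne
  rw [flatDim, hm] at h
  exact hM.mono (by exact_mod_cast h)

theorem weakGlobalDim_le_iff (n : ℕ) :
    weakGlobalDim R ≤ n ↔ ∀ M : ModuleCat.{u} R, flatDimLE R n M := by
  simp only [weakGlobalDim, iSup_le_iff, flatDim_le_iff]

variable (R) in
theorem weakGlobalDim_eq_op : weakGlobalDim R = weakGlobalDim Rᵐᵒᵖ := by
  refine eq_of_forall_ge_iff fun d => ?_
  induction d using ENat.recTopCoe with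
  | top => simp only [le_top]
  | coe n => rw [weakGlobalDim_le_iff, weakGlobalDim_le_iff, forall_flatDimLE_iff_op]

end Tor

section Gorenstein

open NTensor

variable {S : Type u} [Ring S]

theorem IsFlatMod.prod {M N : ModuleCat.{u} S} (hM : IsFlatMod S M) (hN : IsFlatMod S N) :
    IsFlatMod S (ModuleCat.of S (M × N)) := by
  intro A B _ _ _ _ f hf
  rw [injective_iff_map_eq_zero]
  intro t ht
  have h₁ : rmap A (LinearMap.fst S M N) t = 0 :=
    (injective_iff_map_eq_zero _).1 (hM A B f hf) _ (by rw [lmap_rmap, ht, map_zero])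
  have h₂ : rmap A (LinearMap.snd S M N) t = 0 :=
    (injective_iff_map_eq_zero _).1 (hN A B f hf) _ (by rw [lmap_rmap, ht, map_zero])
  have hid : (LinearMap.inl S M N).comp (LinearMap.fst S M N) +
      (LinearMap.inr S M N).comp (LinearMap.snd S M N) = LinearMap.id := by
    ext <;> simp
  have h := rmap_id (A := A) (S := S) (M := M × N) t
  rw [← hid, rmap_add, ← rmap_comp, ← rmap_comp, h₁, h₂, map_zero, map_zero, add_zero] at h
  exact h.symm

/-- The complex with all terms `M × M` and differential `(x, y) ↦ (y, 0)` is contractible, so it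
is a complete flat resolution of a flat module `M`. -/
theorem IsFlatMod.isGorensteinFlat {M : ModuleCat.{u} S} (hM : IsFlatMod S M) :
    IsGorensteinFlat S M := by
  let d : M × M →ₗ[S] M × M := (LinearMap.inl S M M).comp (LinearMap.snd S M M)
  let s : M × M →ₗ[S] M × M := (LinearMap.inr S M M).comp (LinearMap.fst S M M)
  have hdd : d.comp d = 0 := by ext <;> simp [d]
  have hds : d.comp s + s.comp d = LinearMap.id := by ext <;> simp [d, s]
  refine ⟨fun _ => ModuleCat.of S (M × M), fun _ => d, fun _ => hM.prod hM, fun _ x => ?_, ?_,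
    fun I _ _ _ _ t => ?_⟩
  · constructor
    · intro hx
      refine ⟨s x, ?_⟩
      have h : d (s x) + s (d x) = x := DFunLike.congr_fun hds x
      have hx' : d x = 0 := hx
      rwa [hx', map_zero, add_zero] at h
    · rintro ⟨y, rfl⟩
      exact DFunLike.congr_fun hdd y
  · have hr : LinearMap.range d = LinearMap.range (LinearMap.inl S M M) :=
      LinearMap.range_comp_of_range_eq_top _ (LinearMap.range_eq_top.2 Prod.snd_surjective)
    exact ⟨(LinearEquiv.ofInjective (LinearMap.inl S M M) LinearMap.inl_injective).trans
      (LinearEquiv.ofEq _ _ hr.symm)⟩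
  · constructor
    · intro ht
      refine ⟨rmap I s t, ?_⟩
      have h : rmap I d (rmap I s t) + rmap I s (rmap I d t) = t := by
        rw [rmap_comp, rmap_comp, ← rmap_add, hds, rmap_id]
      have ht' : rmap I d t = 0 := ht
      rwa [ht', map_zero, add_zero] at h
    · rintro ⟨y, rfl⟩
      rw [rmap_comp, hdd, rmap_zero]

theorem isFlatMod_range_of_exact {F : ℤ → ModuleCat.{u} S}
    {d : ∀ n : ℤ, F n →ₗ[S] F (n + 1)} (hF : ∀ n, IsFlatMod S (F n))
    (he : ∀ n, Function.Exact (d n) (d (n + 1))) (n : ℕ)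
    (h : ∀ k, flatDimLE S n (ModuleCat.of S (LinearMap.range (d k)))) (k : ℤ) :
    IsFlatMod S (ModuleCat.of S (LinearMap.range (d k))) := by
  induction n with
  | zero => exact h k
  | succ n ih =>
    refine ih fun k => ?_
    refine (h (k + 1)).of_shortExact (ι := (LinearMap.range (d k)).subtype)
      (π := (d (k + 1)).rangeRestrict) (Submodule.injective_subtype _)
      (LinearMap.surjective_rangeRestrict _) ?_ (hF (k + 1))
    rw [LinearMap.exact_iff, LinearMap.ker_rangeRestrict, Submodule.range_subtype]
    exact LinearMap.exact_iff.1 (he k)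

theorem isGorensteinFlat_iff_isFlatMod {n : ℕ} (h : ∀ M : ModuleCat.{u} S, flatDimLE S n M)
    (M : ModuleCat.{u} S) : IsGorensteinFlat S M ↔ IsFlatMod S M := by
  refine ⟨?_, IsFlatMod.isGorensteinFlat⟩
  rintro ⟨F, d, hF, he, ⟨e⟩, -⟩
  exact (isFlatMod_range_of_exact hF he n (fun _ => h _) 0).of_linearEquiv e

theorem gflatDimLE_iff_flatDimLE {n : ℕ} (h : ∀ M : ModuleCat.{u} S, flatDimLE S n M) (m : ℕ)
    (M : ModuleCat.{u} S) : gflatDimLE S m M ↔ flatDimLE S m M := by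
  induction m generalizing M with
  | zero => exact isGorensteinFlat_iff_isFlatMod h M
  | succ m ih => simp only [gflatDimLE, flatDimLE, ih, isGorensteinFlat_iff_isFlatMod h]

variable (S) in
theorem gorensteinWeakGlobalDim_eq_of_ne_top (h : weakGlobalDim S ≠ ⊤) :
    gorensteinWeakGlobalDim S = weakGlobalDim S := by
  obtain ⟨n, hn⟩ := ENat.ne_top_iff_exists.1 h
  have hall := (weakGlobalDim_le_iff n).1 hn.ge
  simp only [gorensteinWeakGlobalDim, weakGlobalDim, gflatDim, flatDim,
    gflatDimLE_iff_flatDimLE hall]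

end Gorenstein

/-- If `R` has finite weak global dimension `wdim(R)` (the common value of the left and right
suprema of flat dimensions), then `l.Gwdim(R) = wdim(R) = r.Gwdim(R)`. -/
theorem gorensteinWeakGlobalDim_eq_weakGlobalDim (R : Type u) [Ring R]
    (hl : weakGlobalDim R ≠ ⊤) (hr : weakGlobalDim Rᵐᵒᵖ ≠ ⊤) :
    gorensteinWeakGlobalDim R = weakGlobalDim R ∧
    weakGlobalDim R = weakGlobalDim Rᵐᵒᵖ ∧
    weakGlobalDim Rᵐᵒᵖ = gorensteinWeakGlobalDim Rᵐᵒᵖ :=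
  ⟨gorensteinWeakGlobalDim_eq_of_ne_top R hl, weakGlobalDim_eq_op R,
    (gorensteinWeakGlobalDim_eq_of_ne_top Rᵐᵒᵖ hr).symm⟩
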